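/- arXiv:1510.09102 — 4 statements merged into one kernel-verified Lean document; each statement's English description precedes it below -/
import Mathlib

section
/- Every transition matrix induced by an arbitrary local strategy is an affine combination of transition matrices induced by the finitely many 'one-deviation' pure local strategies: let D = ⟨Q, μ0, L, δ⟩ be a labelled MDP, fix an arbitrary pure local strategy α_0, and for each q ∈ Q and m ∈ moves(q) let α_{q,m} be the pure local strategy with α_{q,m}(q)(m) = 1 and α_{q,m}(q') = α_0(q') for q' ≠ q. Then for every local strategy α and every label a ∈ L: Δ_α(a) = Δ_{α_0}(a) + Σ_{q∈Q} ( −Δ_{α_0}(a) + Σ_{m∈moves(q)} α(q)(m)·Δ_{α_{q,m}}(a) ). -/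
open Matrix

/-- A labelled Markov decision process (data part): an initial distribution,
a finite nonempty set of available moves at each state, and for each move a
probability distribution on `L × Q`. -/
structure PreMDP (Q L M : Type*) where
  init : Q → ℝ
  moves : Q → Finset M
  prob : M → L → Q → ℝ

/-- The well-formedness conditions making a `PreMDP` a labelled MDP. -/
def IsMDP {Q L M : Type*} [Fintype Q] [Fintype L] (D : PreMDP Q L M) : Prop :=
  (∀ q, 0 ≤ D.init q) ∧ (∑ q, D.init q = 1) ∧
  (∀ q, (D.moves q).Nonempty) ∧
  (∀ m a q', 0 ≤ D.prob m a q') ∧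
  (∀ q, ∀ m ∈ D.moves q, ∑ a : L, ∑ q' : Q, D.prob m a q' = 1)

/-- A path `q0 a1 q1 ⋯ an qn`: the initial state together with the list of
(label, state) steps. -/
abbrev MPath (Q L : Type*) := Q × List (L × Q)

/-- The last state of a path. -/
def MPath.last {Q L : Type*} (ρ : MPath Q L) : Q :=
  (ρ.2.getLast?).elim ρ.1 Prod.snd

/-- The trace of a path. -/
def MPath.trace {Q L : Type*} (ρ : MPath Q L) : List L := ρ.2.map Prod.fst

/-- A strategy: to each path a probability distribution on the moves available
at its last state. -/
def IsStrategy {Q L M : Type*} (D : PreMDP Q L M) (α : MPath Q L → M → ℝ) : Prop :=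
  ∀ ρ : MPath Q L, (∀ m, 0 ≤ α ρ m) ∧ (∀ m, m ∉ D.moves (MPath.last ρ) → α ρ m = 0) ∧
    (∑ m ∈ D.moves (MPath.last ρ), α ρ m = 1)

/-- A strategy is trace-based if it depends only on the trace and the last
state of the path. -/
def TraceBased {Q L M : Type*} (α : MPath Q L → M → ℝ) : Prop :=
  ∀ ρ ρ' : MPath Q L, MPath.trace ρ = MPath.trace ρ' → MPath.last ρ = MPath.last ρ' → α ρ = α ρ'

/-- Probability of performing the given further steps, starting from the path `ρ`. -/
def probFrom {Q L M : Type*} (D : PreMDP Q L M) (α : MPath Q L → M → ℝ) :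
    MPath Q L → List (L × Q) → ℝ
  | _, [] => 1
  | ρ, (a, q) :: rest =>
      (∑ m ∈ D.moves (MPath.last ρ), α ρ m * D.prob m a q) *
        probFrom D α (ρ.1, ρ.2 ++ [(a, q)]) rest

/-- The probability `Pr_{D,α}(ρ)` of a path. -/
def pathProb {Q L M : Type*} (D : PreMDP Q L M) (α : MPath Q L → M → ℝ) (ρ : MPath Q L) : ℝ :=
  D.init ρ.1 * probFrom D α (ρ.1, []) ρ.2

/-- `subDis D α w q` : the total probability of paths with trace `w` ending in `q`. -/
def subDis {Q L M : Type*} [Fintype Q] [DecidableEq Q] (D : PreMDP Q L M)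
    (α : MPath Q L → M → ℝ) (w : List L) (q : Q) : ℝ :=
  ∑ q0 : Q, ∑ f : Fin w.length → Q,
    if MPath.last ((q0, List.ofFn fun i => (w.get i, f i)) : MPath Q L) = q then
      pathProb D α (q0, List.ofFn fun i => (w.get i, f i)) else 0

/-- The trace-probability function `Tr_{D,α}`. -/
def Tr {Q L M : Type*} [Fintype Q] [DecidableEq Q] (D : PreMDP Q L M)
    (α : MPath Q L → M → ℝ) (w : List L) : ℝ :=
  ∑ q : Q, subDis D α w q

/-- A local strategy: to each state a probability distribution on the moves
available there. -/
def IsLocal {Q L M : Type*} (D : PreMDP Q L M) (β : Q → M → ℝ) : Prop :=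
  ∀ q, (∀ m, 0 ≤ β q m) ∧ (∀ m, m ∉ D.moves q → β q m = 0) ∧ (∑ m ∈ D.moves q, β q m = 1)

/-- The transition matrix `Δ_β(a)` of a local strategy `β` and label `a`. -/
def transMat {Q L M : Type*} (D : PreMDP Q L M) (β : Q → M → ℝ) (a : L) : Matrix Q Q ℝ :=
  Matrix.of fun q q' => ∑ m ∈ D.moves q, β q m * D.prob m a q'

/-- `Succ(μ, β, a) = μ · Δ_β(a)`. -/
def Succ {Q L M : Type*} [Fintype Q] (D : PreMDP Q L M) (μ : Q → ℝ) (β : Q → M → ℝ)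
    (a : L) : Q → ℝ :=
  Matrix.vecMul μ (transMat D β a)

/-- Subdistributions over `Q` (viewed as row vectors). -/
def IsSubDist {Q : Type*} [Fintype Q] (μ : Q → ℝ) : Prop :=
  (∀ q, 0 ≤ μ q) ∧ (∑ q, μ q) ≤ 1

/-- A bisimulation between (sub)distributions of two MDPs. -/
def IsBisim {Q Q' L M M' : Type*} [Fintype Q] [Fintype Q'] (D : PreMDP Q L M)
    (E : PreMDP Q' L M') (R : (Q → ℝ) → (Q' → ℝ) → Prop) : Prop :=
  ∀ μ ν, R μ ν →
    ((∑ q, μ q) = (∑ q, ν q)) ∧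
    (∀ β, IsLocal D β → ∃ γ, IsLocal E γ ∧ ∀ a, R (Succ D μ β a) (Succ E ν γ a)) ∧
    (∀ γ, IsLocal E γ → ∃ β, IsLocal D β ∧ ∀ a, R (Succ D μ β a) (Succ E ν γ a))

/-- `μ ∼ ν`: the largest bisimulation (union of all bisimulations). -/
def Bisim {Q Q' L M M' : Type*} [Fintype Q] [Fintype Q'] (D : PreMDP Q L M)
    (E : PreMDP Q' L M') (μ : Q → ℝ) (ν : Q' → ℝ) : Prop :=
  ∃ R, IsBisim D E R ∧ R μ ν

/-- The approximants `∼ₙ` of the bisimulation relation. -/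
def simN {Q L M : Type*} [Fintype Q] (D : PreMDP Q L M) : ℕ → (Q → ℝ) → (Q → ℝ) → Prop
  | 0 => fun μ ν => (∑ q, μ q) = (∑ q, ν q)
  | n + 1 => fun μ ν =>
      ((∑ q, μ q) = (∑ q, ν q)) ∧
      (∀ β, IsLocal D β → ∃ γ, IsLocal D γ ∧ ∀ a, simN D n (Succ D μ β a) (Succ D ν γ a)) ∧
      (∀ γ, IsLocal D γ → ∃ β, IsLocal D β ∧ ∀ a, simN D n (Succ D μ β a) (Succ D ν γ a))

/-- The point `p(μ, β) ∈ ℝ^{L × k}`: the concatenation of the row vectors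
`μ · Δ_β(a) · B` for `a ∈ L`. -/
def point {Q L M : Type*} {k : ℕ} [Fintype Q] (D : PreMDP Q L M) (B : Matrix Q (Fin k) ℝ)
    (μ : Q → ℝ) (β : Q → M → ℝ) : L × Fin k → ℝ :=
  fun x => Matrix.vecMul (Matrix.vecMul μ (transMat D β x.1)) B x.2

/-- `β̂` is extremal in direction `v` with respect to `B`. -/
def ExtremalIn {Q L M : Type*} {k : ℕ} [Fintype Q] [Fintype L] [Fintype M] [DecidableEq Q]
    (D : PreMDP Q L M) (B : Matrix Q (Fin k) ℝ) (βh : Q → M → ℝ) (v : L × Fin k → ℝ) : Prop :=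
  ∀ q : Q, ∀ β, IsLocal D β →
    point D B (Pi.single q 1) β ⬝ᵥ v ≤ point D B (Pi.single q 1) βh ⬝ᵥ v ∧
    (point D B (Pi.single q 1) β ⬝ᵥ v = point D B (Pi.single q 1) βh ⬝ᵥ v →
      point D B (Pi.single q 1) β = point D B (Pi.single q 1) βh)

/-- `β̂` is extremal with respect to `B`: extremal in some direction. -/
def Extremal {Q L M : Type*} {k : ℕ} [Fintype Q] [Fintype L] [Fintype M] [DecidableEq Q]
    (D : PreMDP Q L M) (B : Matrix Q (Fin k) ℝ) (βh : Q → M → ℝ) : Prop :=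
  ∃ v, ExtremalIn D B βh v

/-- The polytope `P_μ = { p(μ, β) : β a local strategy }`. -/
def Pset {Q L M : Type*} {k : ℕ} [Fintype Q] (D : PreMDP Q L M) (B : Matrix Q (Fin k) ℝ)
    (μ : Q → ℝ) : Set (L × Fin k → ℝ) :=
  { x | ∃ β, IsLocal D β ∧ x = point D B μ β }

/-- Column space of a matrix. -/
def colSpace {Q : Type*} {k : ℕ} (B : Matrix Q (Fin k) ℝ) : Submodule ℝ (Q → ℝ) :=
  Submodule.span ℝ (Set.range fun j => fun q => B q j)

/-- The pure local strategy induced by a selection of moves. -/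
def pureOf {Q M : Type*} [DecidableEq M] (f : Q → M) : Q → M → ℝ :=
  fun q m => if m = f q then 1 else 0

/-- The transition matrix of a pure local strategy, entrywise. -/
theorem transMat_pureOf_apply {Q L M : Type*} [DecidableEq M] (D : PreMDP Q L M) {f : Q → M}
    {q : Q} (hf : f q ∈ D.moves q) (a : L) (q' : Q) :
    transMat D (pureOf f) a q q' = D.prob (f q) a q' := by
  simp [transMat, pureOf, hf]

/-- Every transition matrix induced by a local strategy is the stated
affine combination of transition matrices of one-deviation pure local strategies. -/
theorem stmt15 {Q L M : Type*} [Fintype Q] [Fintype L] [Fintype M] [DecidableEq Q]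
    [DecidableEq M]
    (D : PreMDP Q L M) (hD : IsMDP D)
    (f0 : Q → M) (hf0 : ∀ q, f0 q ∈ D.moves q)
    (β : Q → M → ℝ) (hβ : IsLocal D β) (a : L) :
    transMat D β a = transMat D (pureOf f0) a +
      ∑ q : Q, (-(transMat D (pureOf f0) a) +
        ∑ m ∈ D.moves q, β q m • transMat D (pureOf (Function.update f0 q m)) a) := by
  ext i j
  have hsum : ∀ q, (-(transMat D (pureOf f0) a) +
      ∑ m ∈ D.moves q, β q m • transMat D (pureOf (Function.update f0 q m)) a) i j =
      if q = i then -(transMat D (pureOf f0) a i j) + transMat D β a i j else 0 := by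
    intro q
    rw [Matrix.add_apply, Matrix.neg_apply, Matrix.sum_apply]
    simp only [Matrix.smul_apply, smul_eq_mul]
    split_ifs with h
    · subst h
      congr 1
      refine Finset.sum_congr rfl fun m hm => ?_
      rw [transMat_pureOf_apply D (by simpa using hm), Function.update_self]
    · have hi : ∀ m, Function.update f0 q m i = f0 i := fun m =>
        Function.update_of_ne (Ne.symm h) m f0
      have hT : ∀ m, transMat D (pureOf (Function.update f0 q m)) a i j =
          transMat D (pureOf f0) a i j := fun m => by
        rw [transMat_pureOf_apply D (by rw [hi]; exact hf0 i), hi,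
          transMat_pureOf_apply D (hf0 i)]
      simp only [hT]
      rw [← Finset.sum_mul, (hβ q).2.2, one_mul, neg_add_cancel]
  rw [Matrix.add_apply, Matrix.sum_apply, Finset.sum_congr rfl fun q _ => hsum q]
  simp
end

section
/- Let D = ⟨Q, μ0^D, L, δ⟩ be a labelled MDP and let C = ⟨Q_C, μ0^C, L, δ⟩ be a labelled MC with Q_C ⊆ Q. Fix an arbitrary pure local strategy α_0, for each q ∈ Q and m ∈ moves(q) let α_{q,m} be the pure local strategy with α_{q,m}(q)(m) = 1 and α_{q,m}(q') = α_0(q') for q' ≠ q, and let Σ = {α_0} ∪ {α_{q,m} : q ∈ Q, m ∈ moves(q)}. Define labelled MCs D' = ⟨Q, μ0^D, L', δ'⟩ and C' = ⟨Q, μ0^C, L', δ'⟩ over the label set L' = {b_{α,a} : α ∈ Σ, a ∈ L}, whose transition matrices are Δ'(b_{α,a}) = (1/|Σ|)·Δ_α(a) (these matrices sum to a stochastic matrix over all labels in L'). Then D ⊑ C if and only if Tr_{D'} = Tr_{C'}. -/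
open Matrix

/-- `μ` is supported in the set `S`. -/
def SuppIn {Q : Type*} (μ : Q → ℝ) (S : Finset Q) : Prop := ∀ q ∉ S, μ q = 0

/-- The set `Σ` of one-deviation pure local strategies (as move selections):
`α0` together with all `α_{q,m}`. -/
def sigma0 {Q L M : Type*} [Fintype Q] [DecidableEq Q] [DecidableEq M]
    (D : PreMDP Q L M) (f0 : Q → M) : Finset (Q → M) :=
  insert f0 ((Finset.univ.sigma fun q => D.moves q).image fun p => Function.update f0 p.1 p.2)

/-- The transition matrices `Δ'(b_{α,a}) = (1/|Σ|)·Δ_α(a)` of the MCs `D'` and `C'`,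
over the label set `L' = Σ × L`. -/
noncomputable def primeMat {Q L M : Type*} [Fintype Q] [DecidableEq Q] [DecidableEq M]
    (D : PreMDP Q L M) (f0 : Q → M) :
    ({f // f ∈ sigma0 D f0} × L) → Matrix Q Q ℝ :=
  fun b => (((sigma0 D f0).card : ℝ))⁻¹ • transMat D (pureOf b.1.1) b.2

/-- The MC on state space `Q` with initial distribution `μ` and transition matrices `Δ`:
each state has a unique move. -/
def mcOf {Q L' : Type*} (μ : Q → ℝ) (Δ : L' → Matrix Q Q ℝ) : PreMDP Q L' Q :=
  ⟨μ, fun q => {q}, fun q b q' => Δ b q q'⟩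

/-- The expectation of `F` over the continuations with trace `w` of the path `ρ`. -/
def expFrom {Q L M : Type*} [Fintype Q] (D : PreMDP Q L M) (α : MPath Q L → M → ℝ)
    (F : MPath Q L → ℝ) : MPath Q L → List L → ℝ
  | ρ, [] => F ρ
  | ρ, a :: w => ∑ q, (∑ m ∈ D.moves (MPath.last ρ), α ρ m * D.prob m a q) *
      expFrom D α F (ρ.1, ρ.2 ++ [(a, q)]) w

/-- The expectation of `F` over the paths with trace `w`. -/
def pathExp {Q L M : Type*} [Fintype Q] (D : PreMDP Q L M) (α : MPath Q L → M → ℝ)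
    (F : MPath Q L → ℝ) (w : List L) : ℝ :=
  ∑ q, D.init q * expFrom D α F (q, []) w

theorem MPath.last_concat {Q L : Type*} (q₀ q : Q) (a : L) (l : List (L × Q)) :
    MPath.last ((q₀, l ++ [(a, q)]) : MPath Q L) = q := by
  simp [MPath.last]

section Expectation

variable {Q L M : Type*} [Fintype Q] (D : PreMDP Q L M) (α : MPath Q L → M → ℝ)

theorem sum_probFrom (F : MPath Q L → ℝ) (w : List L) (ρ : MPath Q L) :
    ∑ f : Fin w.length → Q, probFrom D α ρ (List.ofFn fun i => (w.get i, f i)) *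
      F (ρ.1, ρ.2 ++ List.ofFn fun i => (w.get i, f i)) = expFrom D α F ρ w := by
  induction w generalizing ρ with
  | nil => simp [expFrom, probFrom]
  | cons a w ih =>
    rw [expFrom]
    refine ((Fin.consEquiv fun _ : Fin (w.length + 1) => Q).sum_comp _).symm.trans ?_
    rw [Fintype.sum_prod_type]
    refine Finset.sum_congr rfl fun q _ => ?_
    rw [← ih, Finset.mul_sum]
    refine Finset.sum_congr rfl fun f _ => ?_
    have h : (List.ofFn fun i : Fin (a :: w).length =>
        ((a :: w).get i, (Fin.consEquiv fun _ : Fin (w.length + 1) => Q) (q, f) i)) =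
        (a, q) :: List.ofFn fun i => (w.get i, f i) := by
      exact (List.ofFn_succ (n := w.length)).trans (by simp [Fin.consEquiv])
    rw [h, probFrom, mul_assoc, List.append_assoc, List.singleton_append]

theorem Tr_eq_pathExp [DecidableEq Q] (w : List L) :
    Tr D α w = pathExp D α (fun _ => 1) w := by
  unfold Tr subDis pathExp
  rw [Finset.sum_comm]
  refine Finset.sum_congr rfl fun q₀ _ => ?_
  rw [Finset.sum_comm, ← sum_probFrom, Finset.mul_sum]
  refine Finset.sum_congr rfl fun f _ => ?_
  simp [pathProb]

theorem expFrom_concat (F : MPath Q L → ℝ) (w : List L) (a : L) (ρ : MPath Q L) :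
    expFrom D α F ρ (w ++ [a]) =
      expFrom D α (fun ρ => ∑ q, (∑ m ∈ D.moves (MPath.last ρ), α ρ m * D.prob m a q) *
        F (ρ.1, ρ.2 ++ [(a, q)])) ρ w := by
  induction w generalizing ρ with
  | nil => simp [expFrom]
  | cons b w ih => simp only [List.cons_append, expFrom, ih]

theorem pathExp_concat (v : Q → ℝ) (w : List L) (a : L) :
    pathExp D α (fun ρ => v (MPath.last ρ)) (w ++ [a]) =
      pathExp D α (fun ρ => ∑ q, (∑ m ∈ D.moves (MPath.last ρ), α ρ m * D.prob m a q) * v q)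
        w := by
  simp only [pathExp, expFrom_concat, MPath.last_concat]

variable {D α}

theorem expFrom_mono (hα : IsStrategy D α) (hprob : ∀ m a q, 0 ≤ D.prob m a q)
    {F G : MPath Q L → ℝ} (hFG : ∀ ρ, F ρ ≤ G ρ) (w : List L) (ρ : MPath Q L) :
    expFrom D α F ρ w ≤ expFrom D α G ρ w := by
  induction w generalizing ρ with
  | nil => exact hFG ρ
  | cons a w ih =>
    exact Finset.sum_le_sum fun q _ => mul_le_mul_of_nonneg_left (ih _)
      (Finset.sum_nonneg fun m _ => mul_nonneg ((hα ρ).1 m) (hprob m a q))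

theorem pathExp_mono (hα : IsStrategy D α) (hinit : ∀ q, 0 ≤ D.init q)
    (hprob : ∀ m a q, 0 ≤ D.prob m a q)
    {F G : MPath Q L → ℝ} (hFG : ∀ ρ, F ρ ≤ G ρ) (w : List L) :
    pathExp D α F w ≤ pathExp D α G w :=
  Finset.sum_le_sum fun q _ =>
    mul_le_mul_of_nonneg_left (expFrom_mono hα hprob hFG w _) (hinit q)

end Expectation

theorem transMat_pureOf_mulVec {Q L M : Type*} [Fintype Q] [DecidableEq M]
    {D : PreMDP Q L M} {f : Q → M} (hf : ∀ q, f q ∈ D.moves q) (a : L) (v : Q → ℝ) (q : Q) :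
    (transMat D (pureOf f) a *ᵥ v) q = ∑ q', D.prob (f q) a q' * v q' := by
  simp [transMat, pureOf, mulVec, dotProduct, hf]

theorem isStrategy_pureOf {Q L M : Type*} [DecidableEq M] {D : PreMDP Q L M}
    {f : MPath Q L → Q → M} (hf : ∀ ρ q, f ρ q ∈ D.moves q) :
    IsStrategy D fun ρ => pureOf (f ρ) (MPath.last ρ) := by
  refine fun ρ => ⟨fun m => ?_, fun m hm => ?_, ?_⟩
  · simp only [pureOf]; split_ifs <;> norm_num
  · have : m ≠ f ρ (MPath.last ρ) := fun h => hm (h ▸ hf ρ _)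
    simp [pureOf, this]
  · simp [pureOf, hf]

theorem Tr_mcOf {Q L' : Type*} [Fintype Q] [DecidableEq Q] (μ : Q → ℝ)
    (Δ : L' → Matrix Q Q ℝ) {γ : MPath Q L' → Q → ℝ} (hγ : IsStrategy (mcOf μ Δ) γ)
    (u : List L') : Tr (mcOf μ Δ) γ u = μ ⬝ᵥ ((u.map Δ).prod *ᵥ 1) := by
  rw [Tr_eq_pathExp]
  refine Finset.sum_congr rfl fun q _ => congrArg (μ q * ·) ?_
  suffices h : ∀ ρ : MPath Q L', expFrom (mcOf μ Δ) γ (fun _ => 1) ρ u =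
      ((u.map Δ).prod *ᵥ 1) (MPath.last ρ) from h (q, [])
  induction u with
  | nil => simp [expFrom]
  | cons b u ih =>
    intro ρ
    have h1 : γ ρ (MPath.last ρ) = 1 := by simpa [mcOf] using (hγ ρ).2.2
    simp only [expFrom, ih, MPath.last_concat, List.map_cons, List.prod_cons, ← mulVec_mulVec]
    simp [mcOf, h1, mulVec, dotProduct]

/-- Playing at the `i`-th step the selection prescribed by the `i`-th letter of `u` yields the
corresponding product of transition matrices. -/
theorem expFrom_timed {Q L M A : Type*} [Fintype Q] [DecidableEq Q] [DecidableEq M]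
    (D : PreMDP Q L M) (sel : A → Q → M) (α : MPath Q L → M → ℝ) (u : List (A × L))
    (ρ : MPath Q L)
    (hα : ∀ (i : ℕ) (hi : i < u.length) (ρ' : MPath Q L), ρ'.2.length = ρ.2.length + i →
      α ρ' = pureOf (sel u[i].1) (MPath.last ρ')) :
    expFrom D α (fun _ => 1) ρ (u.map Prod.snd) =
      ((u.map fun b => transMat D (pureOf (sel b.1)) b.2).prod *ᵥ 1) (MPath.last ρ) := by
  induction u generalizing ρ with
  | nil => simp [expFrom]
  | cons b u ih =>
    have hρ : α ρ = pureOf (sel b.1) (MPath.last ρ) := hα 0 (by simp) ρ rfl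
    simp only [List.map_cons, expFrom, List.prod_cons, ← mulVec_mulVec]
    refine Finset.sum_congr rfl fun q _ => ?_
    rw [ih, MPath.last_concat, hρ]
    · rfl
    · intro i hi ρ' hρ'
      exact hα (i + 1) (by simpa using hi) ρ' (by simp at hρ'; omega)

theorem prod_map_smul {Q B : Type*} [Fintype Q] [DecidableEq Q] (c : ℝ)
    (Δ : B → Matrix Q Q ℝ) (u : List B) :
    (u.map fun b => c • Δ b).prod = c ^ u.length • (u.map Δ).prod := by
  induction u with
  | nil => simp
  | cons b u ih => simp [ih, smul_smul, pow_succ]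

section Sigma

variable {Q L M : Type*} [Fintype Q] [DecidableEq Q] [DecidableEq M] {D : PreMDP Q L M}
  {f0 : Q → M}

theorem mem_moves_of_mem_sigma0 (hf0 : ∀ q, f0 q ∈ D.moves q) {f : Q → M}
    (hf : f ∈ sigma0 D f0) (q : Q) : f q ∈ D.moves q := by
  simp only [sigma0, Finset.mem_insert, Finset.mem_image, Finset.mem_sigma, Finset.mem_univ,
    true_and] at hf
  obtain rfl | ⟨⟨p, m⟩, hm, rfl⟩ := hf
  · exact hf0 q
  · rcases eq_or_ne q p with rfl | h
    · simpa using hm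
    · simpa [h] using hf0 q

theorem self_mem_sigma0 : f0 ∈ sigma0 D f0 := Finset.mem_insert_self _ _

theorem update_mem_sigma0 {q : Q} {m : M} (hm : m ∈ D.moves q) :
    Function.update f0 q m ∈ sigma0 D f0 :=
  Finset.mem_insert_of_mem (Finset.mem_image.2 ⟨⟨q, m⟩, by simpa using hm, rfl⟩)

theorem sigma0_card_ne_zero : ((sigma0 D f0).card : ℝ) ≠ 0 :=
  Nat.cast_ne_zero.2 (Finset.card_ne_zero_of_mem self_mem_sigma0)

theorem sub_mulVec_update (hf0 : ∀ q, f0 q ∈ D.moves q) {q : Q} {m : M} (hm : m ∈ D.moves q)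
    (a : L) (v : Q → ℝ) :
    transMat D (pureOf (Function.update f0 q m)) a *ᵥ v - transMat D (pureOf f0) a *ᵥ v =
      Pi.single q (∑ q', D.prob m a q' * v q' - ∑ q', D.prob (f0 q) a q' * v q') := by
  ext p
  rw [Pi.sub_apply, transMat_pureOf_mulVec hf0,
    transMat_pureOf_mulVec (mem_moves_of_mem_sigma0 hf0 (update_mem_sigma0 hm))]
  rcases eq_or_ne p q with rfl | h
  · simp
  · simp [h]

/-- A word of pure transition matrices does not leave a closed set of states. -/
theorem prod_mulVec_eq_zero (hf0 : ∀ q, f0 q ∈ D.moves q) {S : Finset Q}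
    (hclosed : ∀ q ∈ S, ∀ m ∈ D.moves q, ∀ (a : L) (q' : Q), D.prob m a q' ≠ 0 → q' ∈ S)
    {v : Q → ℝ} (hv : ∀ q ∈ S, v q = 0) (w : List L) (q : Q) (hq : q ∈ S) :
    ((w.map (transMat D (pureOf f0))).prod *ᵥ v) q = 0 := by
  induction w generalizing q with
  | nil => simpa using hv q hq
  | cons a w ih =>
    rw [List.map_cons, List.prod_cons, ← mulVec_mulVec, transMat_pureOf_mulVec hf0]
    refine Finset.sum_eq_zero fun q' _ => ?_
    by_cases h : D.prob (f0 q) a q' = 0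
    · simp [h]
    · rw [ih q' (hclosed q hq _ (hf0 q) a q' h), mul_zero]

/-- On a space of vectors that is invariant under the one-deviation transition matrices and on
which the initial distribution agrees with `μC`, every strategy behaves like the pure local
strategy `f0` started in `μC`. -/
theorem pathExp_eq_of_invariant (hinit : ∀ q, 0 ≤ D.init q)
    (hprob : ∀ m a q, 0 ≤ D.prob m a q) {QC : Finset Q} {μC : Q → ℝ} (hsupp : SuppIn μC QC)
    (hone : ∀ q ∈ QC, (D.moves q).card = 1)
    (hclosed : ∀ q ∈ QC, ∀ m ∈ D.moves q, ∀ (a : L) (q' : Q), D.prob m a q' ≠ 0 → q' ∈ QC)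
    (hf0 : ∀ q, f0 q ∈ D.moves q) (V : Submodule ℝ (Q → ℝ))
    (hV : ∀ f ∈ sigma0 D f0, ∀ a, ∀ v ∈ V, transMat D (pureOf f) a *ᵥ v ∈ V)
    (hVμ : ∀ v ∈ V, D.init ⬝ᵥ v = μC ⬝ᵥ v)
    {α : MPath Q L → M → ℝ} (hα : IsStrategy D α) (w : List L) (v : Q → ℝ) (hv : v ∈ V) :
    pathExp D α (fun ρ => v (MPath.last ρ)) w =
      μC ⬝ᵥ ((w.map (transMat D (pureOf f0))).prod *ᵥ v) := by
  induction w using List.reverseRecOn generalizing v with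
  | nil =>
    rw [List.map_nil, List.prod_nil, one_mulVec, ← hVμ v hv]
    rfl
  | append_singleton w a ih =>
    set g : M → ℝ := fun m => ∑ q', D.prob m a q' * v q' with hg
    set v₀ : Q → ℝ := transMat D (pureOf f0) a *ᵥ v with hv₀
    set K : Q → ℝ := ∑ q, ∑ m ∈ D.moves q, Pi.single q |g m - g (f0 q)| with hK
    have hKq (q : Q) : K q = ∑ m ∈ D.moves q, |g m - g (f0 q)| := by
      simp only [hK, Finset.sum_apply]
      rw [Finset.sum_eq_single q]
      · simp
      · intro p _ hp
        simp [hp.symm]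
      · simp
    have hv₀V : v₀ ∈ V := hV f0 self_mem_sigma0 a v hv
    have hKV : K ∈ V := by
      refine V.sum_mem fun q _ => V.sum_mem fun m hm => ?_
      have h : Pi.single q (g m - g (f0 q)) ∈ V := by
        rw [hg, ← sub_mulVec_update hf0 hm]
        exact V.sub_mem (hV _ (update_mem_sigma0 hm) a v hv) hv₀V
      rcases abs_choice (g m - g (f0 q)) with h' | h' <;> rw [h']
      · exact h
      · rw [Pi.single_neg]
        exact V.neg_mem h
    have hK0 : μC ⬝ᵥ ((w.map (transMat D (pureOf f0))).prod *ᵥ K) = 0 := by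
      refine Finset.sum_eq_zero fun q _ => ?_
      by_cases hq : q ∈ QC
      · rw [prod_mulVec_eq_zero hf0 hclosed (fun p hp => ?_) w q hq, mul_zero]
        obtain ⟨m, hm⟩ := Finset.card_eq_one.1 (hone p hp)
        have hm' : f0 p = m := by simpa [hm] using hf0 p
        rw [hKq, hm, Finset.sum_singleton, hm', sub_self, abs_zero]
      · rw [hsupp q hq, zero_mul]
    have hstep (ρ : MPath Q L) :
        ∑ q, (∑ m ∈ D.moves (MPath.last ρ), α ρ m * D.prob m a q) * v q =
          ∑ m ∈ D.moves (MPath.last ρ), α ρ m * g m := by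
      simp only [hg, Finset.sum_mul, Finset.mul_sum, mul_assoc]
      exact Finset.sum_comm
    have hbound (ρ : MPath Q L) (m : M) (hm : m ∈ D.moves (MPath.last ρ)) :
        |g m - v₀ (MPath.last ρ)| ≤ K (MPath.last ρ) := by
      rw [hKq, hv₀, transMat_pureOf_mulVec hf0]
      exact Finset.single_le_sum (f := fun m => |g m - g (f0 (MPath.last ρ))|)
        (fun _ _ => abs_nonneg _) hm
    have hconst (ρ : MPath Q L) (c : ℝ) : ∑ m ∈ D.moves (MPath.last ρ), α ρ m * c = c := by
      rw [← Finset.sum_mul, (hα ρ).2.2, one_mul]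
    rw [pathExp_concat, List.map_append, List.prod_append, List.map_singleton,
      List.prod_singleton, ← mulVec_mulVec, ← hv₀]
    simp only [hstep]
    apply le_antisymm
    · refine (pathExp_mono hα hinit hprob (G := fun ρ => (v₀ + K) (MPath.last ρ))
        (fun ρ => ?_) w).trans_eq ?_
      · rw [← hconst ρ ((v₀ + K) (MPath.last ρ))]
        refine Finset.sum_le_sum fun m hm => mul_le_mul_of_nonneg_left ?_ ((hα ρ).1 m)
        have := (abs_le.1 (hbound ρ m hm)).2
        rw [Pi.add_apply]
        linarith
      · rw [ih _ (V.add_mem hv₀V hKV), mulVec_add, dotProduct_add, hK0, add_zero]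
    · refine Eq.trans_le ?_ (pathExp_mono hα hinit hprob
        (F := fun ρ => (v₀ - K) (MPath.last ρ)) (fun ρ => ?_) w)
      · rw [ih _ (V.sub_mem hv₀V hKV), mulVec_sub, dotProduct_sub, hK0, sub_zero]
      · rw [← hconst ρ ((v₀ - K) (MPath.last ρ))]
        refine Finset.sum_le_sum fun m hm => mul_le_mul_of_nonneg_left ?_ ((hα ρ).1 m)
        have := (abs_le.1 (hbound ρ m hm)).1
        rw [Pi.sub_apply]
        linarith

end Sigma

/-- The vectors on which `μ` and `ν` agree after every word of matrices from `Δ`. -/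
def wordAgree {Q B : Type*} [Fintype Q] [DecidableEq Q] (Δ : B → Matrix Q Q ℝ) (μ ν : Q → ℝ) :
    Submodule ℝ (Q → ℝ) where
  carrier := {v | ∀ u : List B, μ ⬝ᵥ ((u.map Δ).prod *ᵥ v) = ν ⬝ᵥ ((u.map Δ).prod *ᵥ v)}
  add_mem' hv hw u := by simp only [mulVec_add, dotProduct_add, hv u, hw u]
  zero_mem' u := by simp
  smul_mem' c v hv u := by simp only [mulVec_smul, dotProduct_smul, hv u]

theorem mulVec_mem_wordAgree {Q B : Type*} [Fintype Q] [DecidableEq Q]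
    {Δ : B → Matrix Q Q ℝ} {μ ν v : Q → ℝ} (hv : v ∈ wordAgree Δ μ ν) (b : B) :
    Δ b *ᵥ v ∈ wordAgree Δ μ ν := fun u => by
  simpa using hv (u ++ [b])

theorem transMat_mulVec_mem_wordAgree {Q L M : Type*} [Fintype Q] [DecidableEq Q]
    [DecidableEq M] {D : PreMDP Q L M} {f0 : Q → M} {μ ν v : Q → ℝ}
    (hv : v ∈ wordAgree (primeMat D f0) μ ν) {f : Q → M} (hf : f ∈ sigma0 D f0) (a : L) :
    transMat D (pureOf f) a *ᵥ v ∈ wordAgree (primeMat D f0) μ ν := by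
  have h := Submodule.smul_mem _ ((sigma0 D f0).card : ℝ)
    (mulVec_mem_wordAgree hv (⟨f, hf⟩, a))
  rwa [primeMat, smul_mulVec, smul_smul, mul_inv_cancel₀ sigma0_card_ne_zero, one_smul] at h

/-- `D ⊑ C` iff the MCs `D'` and `C'` (over the label set `Σ × L`, with
transition matrices `(1/|Σ|)·Δ_α(a)`) have equal trace functions. Here `C` is the MC given
by the closed subset `QC` of states of `D` with unique moves, with initial distribution
`μC`. -/
theorem stmt16 {Q L M : Type*} [Fintype Q] [Fintype L] [Fintype M] [DecidableEq Q]
    [DecidableEq M]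
    (D : PreMDP Q L M) (hD : IsMDP D)
    (QC : Finset Q) (μC : Q → ℝ)
    (hμC0 : ∀ q, 0 ≤ μC q) (hμC1 : ∑ q, μC q = 1) (hsupp : SuppIn μC QC)
    (hone : ∀ q ∈ QC, (D.moves q).card = 1)
    (hclosed : ∀ q ∈ QC, ∀ m ∈ D.moves q, ∀ (a : L) (q' : Q), D.prob m a q' ≠ 0 → q' ∈ QC)
    (f0 : Q → M) (hf0 : ∀ q, f0 q ∈ D.moves q) :
    (∀ α, IsStrategy D α → ∀ γ, IsStrategy ({ D with init := μC } : PreMDP Q L M) γ →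
        Tr D α = Tr ({ D with init := μC } : PreMDP Q L M) γ) ↔
    (∀ γ γ', IsStrategy (mcOf D.init (primeMat D f0)) γ →
        IsStrategy (mcOf μC (primeMat D f0)) γ' →
        Tr (mcOf D.init (primeMat D f0)) γ = Tr (mcOf μC (primeMat D f0)) γ') := by
  constructor
  · intro h γ γ' hγ hγ'
    funext u
    rw [Tr_mcOf _ _ hγ, Tr_mcOf _ _ hγ']
    let f : MPath Q L → Q → M := fun ρ =>
      if hρ : ρ.2.length < u.length then u[ρ.2.length].1.1 else f0
    have hf (ρ : MPath Q L) (q : Q) : f ρ q ∈ D.moves q := by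
      simp only [f]
      split_ifs
      · exact mem_moves_of_mem_sigma0 hf0 (Subtype.prop _) q
      · exact hf0 q
    have key (E : PreMDP Q L M) (q : Q) := expFrom_timed E (fun p : {f // f ∈ sigma0 D f0} => p.1)
      (fun ρ => pureOf (f ρ) (MPath.last ρ)) u (q, []) fun i hi ρ' hρ' => by
        obtain rfl : ρ'.2.length = i := by simpa using hρ'
        simp [f, hi]
    have hTr := congrFun (h _ (isStrategy_pureOf hf) _ (isStrategy_pureOf hf)) (u.map Prod.snd)
    simp only [Tr_eq_pathExp, pathExp, key] at hTr
    unfold primeMat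
    rw [prod_map_smul, smul_mulVec, dotProduct_smul, dotProduct_smul]
    exact congrArg _ hTr
  · intro h α hα γ hγ
    obtain ⟨hinit, -, -, hprob, -⟩ := hD
    have hstr (μ : Q → ℝ) : IsStrategy (mcOf μ (primeMat D f0))
        fun ρ => pureOf id (MPath.last ρ) :=
      isStrategy_pureOf (f := fun _ => id) fun _ q => Finset.mem_singleton_self q
    have h1 : (1 : Q → ℝ) ∈ wordAgree (primeMat D f0) D.init μC := fun u => by
      rw [← Tr_mcOf _ _ (hstr D.init), ← Tr_mcOf _ _ (hstr μC),
        h _ _ (hstr D.init) (hstr μC)]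
    have hV : ∀ f ∈ sigma0 D f0, ∀ a, ∀ v ∈ wordAgree (primeMat D f0) D.init μC,
        transMat D (pureOf f) a *ᵥ v ∈ wordAgree (primeMat D f0) D.init μC :=
      fun f hf a v hv => transMat_mulVec_mem_wordAgree hv hf a
    funext w
    rw [Tr_eq_pathExp, Tr_eq_pathExp]
    exact (pathExp_eq_of_invariant hinit hprob hsupp hone hclosed hf0 _ hV
      (fun v hv => by simpa using hv []) hα w 1 h1).trans
      (pathExp_eq_of_invariant (D := { D with init := μC }) hμC0 hprob hsupp hone hclosed hf0 _
        hV (fun _ _ => rfl) hγ w 1 h1).symm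
end

section
/- Let D = ⟨Q, μ0, L, δ⟩ and E = ⟨Q', μ0', L, δ'⟩ be labelled MDPs over the same alphabet L, and let # ∉ L be a fresh label. Let D+E be the MDP consisting of disjoint copies of D and E together with a fresh initial state p0 (its initial distribution is Dirac on p0) having exactly two moves m_D and m_E, where m_D(#,q) = μ0(q) for q ∈ Q (and 0 otherwise) and m_E(#,q) = μ0'(q) for q ∈ Q' (and 0 otherwise). Let E₂ be the MDP obtained from E by adding a fresh initial state q0 (initial distribution Dirac on q0) with a single move m with m(#,q) = μ0'(q). Then: (i) E₂ ⊑ D+E always holds; and (ii) D ⊑ E if and only if both E₂ ⊑ D+E and D+E ⊑ E₂. -/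
open Matrix

/-- Trace refinement `D ⊑ E`. -/
def Refines {Q Q' L M M' : Type*} [Fintype Q] [Fintype Q'] [DecidableEq Q] [DecidableEq Q']
    (D : PreMDP Q L M) (E : PreMDP Q' L M') : Prop :=
  ∀ α, IsStrategy D α → ∃ β, IsStrategy E β ∧ Tr D α = Tr E β

/-- The MDP `D + E`: a fresh initial state `p0` (= `none`) with two moves `m_D` (= `inl true`)
and `m_E` (= `inl false`) emitting the fresh label `#` (= `none`) and moving to the initial
distribution of a copy of `D`, resp. of `E`. -/
def plusMDP {QD QE L MD ME : Type*} [DecidableEq MD] [DecidableEq ME]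
    (D : PreMDP QD L MD) (E : PreMDP QE L ME) :
    PreMDP (Option (QD ⊕ QE)) (Option L) (Bool ⊕ (MD ⊕ ME)) where
  init := fun s => match s with | none => 1 | some _ => 0
  moves := fun s => match s with
    | none => {Sum.inl true, Sum.inl false}
    | some (Sum.inl q) => (D.moves q).image (fun m => Sum.inr (Sum.inl m))
    | some (Sum.inr q) => (E.moves q).image (fun m => Sum.inr (Sum.inr m))
  prob := fun m a s => match m, a, s with
    | Sum.inl true, none, some (Sum.inl q) => D.init q
    | Sum.inl false, none, some (Sum.inr q) => E.init q
    | Sum.inr (Sum.inl mm), some a, some (Sum.inl q) => D.prob mm a q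
    | Sum.inr (Sum.inr mm), some a, some (Sum.inr q) => E.prob mm a q
    | _, _, _ => 0

/-- The MDP `E₂`: a fresh initial state `q0` (= `none`) with a single move (= `none`)
emitting the fresh label `#` (= `none`) and moving to the initial distribution of `E`. -/
def extMDP {QE L ME : Type*} [DecidableEq ME] (E : PreMDP QE L ME) :
    PreMDP (Option QE) (Option L) (Option ME) where
  init := fun s => match s with | none => 1 | some _ => 0
  moves := fun s => match s with
    | none => {none}
    | some q => (E.moves q).image some
  prob := fun m a s => match m, a, s with
    | none, none, some q => E.init q
    | some mm, some a, some q => E.prob mm a q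
    | _, _, _ => 0

/-- The one-step probability of emitting `a` and moving to `q` after the path `ρ`. -/
def stepProb {Q L M : Type*} (D : PreMDP Q L M) (α : MPath Q L → M → ℝ) (ρ : MPath Q L)
    (a : L) (q : Q) : ℝ :=
  ∑ m ∈ D.moves (MPath.last ρ), α ρ m * D.prob m a q

/-- The probability of continuing the path `ρ` with the trace `w`. -/
def traceFrom {Q L M : Type*} [Fintype Q] (D : PreMDP Q L M) (α : MPath Q L → M → ℝ) :
    MPath Q L → List L → ℝ
  | _, [] => 1
  | ρ, a :: w => ∑ q, stepProb D α ρ a q * traceFrom D α (ρ.1, ρ.2 ++ [(a, q)]) w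

lemma sum_probFrom_eq_traceFrom {Q L M : Type*} [Fintype Q] (D : PreMDP Q L M)
    (α : MPath Q L → M → ℝ) (w : List L) (ρ : MPath Q L) :
    ∑ f : Fin w.length → Q, probFrom D α ρ (List.ofFn fun i => (w.get i, f i)) =
      traceFrom D α ρ w := by
  induction w generalizing ρ with
  | nil => simp [probFrom, traceFrom]
  | cons a w ih =>
    have h := (Fin.consEquiv (n := w.length) (fun _ => Q)).sum_comp
      (fun f => probFrom D α ρ (List.ofFn fun i => ((a :: w).get i, f i)))
    refine h.symm.trans ?_
    rw [Fintype.sum_prod_type, traceFrom]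
    refine Finset.sum_congr rfl fun q _ => ?_
    rw [← ih, Finset.mul_sum]
    refine Finset.sum_congr rfl fun f _ => ?_
    change probFrom D α ρ (List.ofFn (n := w.length + 1) _) = _
    rw [List.ofFn_succ]
    rfl

lemma Tr_eq_sum_pathProb {Q L M : Type*} [Fintype Q] [DecidableEq Q] (D : PreMDP Q L M)
    (α : MPath Q L → M → ℝ) (w : List L) :
    Tr D α w = ∑ q0 : Q, ∑ f : Fin w.length → Q,
      pathProb D α (q0, List.ofFn fun i => (w.get i, f i)) := by
  unfold Tr subDis
  rw [Finset.sum_comm]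
  refine Finset.sum_congr rfl fun q0 _ => ?_
  rw [Finset.sum_comm]
  refine Finset.sum_congr rfl fun f _ => ?_
  simp

lemma Tr_eq_sum_traceFrom {Q L M : Type*} [Fintype Q] [DecidableEq Q] (D : PreMDP Q L M)
    (α : MPath Q L → M → ℝ) (w : List L) :
    Tr D α w = ∑ q, D.init q * traceFrom D α (q, []) w := by
  rw [Tr_eq_sum_pathProb]
  refine Finset.sum_congr rfl fun q _ => ?_
  rw [← sum_probFrom_eq_traceFrom, Finset.mul_sum]
  rfl

lemma MPath.last_append {Q L : Type*} (q0 : Q) (l : List (L × Q)) (x : L × Q) :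
    MPath.last (q0, l ++ [x]) = x.2 := by
  simp [MPath.last]

/-! ### Convex combinations of strategies -/

lemma probFrom_append {Q L M : Type*} (D : PreMDP Q L M) (α : MPath Q L → M → ℝ)
    (ρ : MPath Q L) (l : List (L × Q)) (a : L) (q : Q) :
    probFrom D α ρ (l ++ [(a, q)]) =
      probFrom D α ρ l * stepProb D α (ρ.1, ρ.2 ++ l) a q := by
  induction l generalizing ρ with
  | nil => simp [probFrom, stepProb]
  | cons x l ih =>
    obtain ⟨b, r⟩ := x
    simp only [List.cons_append, probFrom, ih, mul_assoc, List.append_assoc, List.nil_append]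

lemma probFrom_nonneg {Q L M : Type*} {D : PreMDP Q L M} {α : MPath Q L → M → ℝ}
    (hD : ∀ m a q, 0 ≤ D.prob m a q) (hα : IsStrategy D α) (ρ : MPath Q L)
    (l : List (L × Q)) : 0 ≤ probFrom D α ρ l := by
  induction l generalizing ρ with
  | nil => simp [probFrom]
  | cons x l ih =>
    exact mul_nonneg (Finset.sum_nonneg fun m _ => mul_nonneg ((hα ρ).1 m) (hD _ _ _)) (ih _)

/-- Strategies are closed under convex combinations, at the level of path probabilities. -/
lemma exists_strategy_mix {Q L M : Type*} {D : PreMDP Q L M} (hD : ∀ m a q, 0 ≤ D.prob m a q)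
    {α β : MPath Q L → M → ℝ} (hα : IsStrategy D α) (hβ : IsStrategy D β)
    {c d : ℝ} (hc : 0 ≤ c) (hd : 0 ≤ d) (hcd : c + d = 1) :
    ∃ γ, IsStrategy D γ ∧ ∀ ρ, pathProb D γ ρ = c * pathProb D α ρ + d * pathProb D β ρ := by
  classical
  let A : MPath Q L → ℝ := fun ρ => c * probFrom D α (ρ.1, []) ρ.2
  let B : MPath Q L → ℝ := fun ρ => d * probFrom D β (ρ.1, []) ρ.2
  have hA : ∀ ρ, 0 ≤ A ρ := fun ρ => mul_nonneg hc (probFrom_nonneg hD hα _ _)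
  have hB : ∀ ρ, 0 ≤ B ρ := fun ρ => mul_nonneg hd (probFrom_nonneg hD hβ _ _)
  let γ : MPath Q L → M → ℝ := fun ρ m =>
    if A ρ + B ρ = 0 then α ρ m else (A ρ * α ρ m + B ρ * β ρ m) / (A ρ + B ρ)
  have hγ : ∀ ρ m, (A ρ + B ρ) * γ ρ m = A ρ * α ρ m + B ρ * β ρ m := by
    intro ρ m
    by_cases h : A ρ + B ρ = 0
    · have h1 : A ρ = 0 := by linarith [hA ρ, hB ρ]
      have h2 : B ρ = 0 := by linarith [hA ρ, hB ρ]
      simp [h1, h2]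
    · simp only [γ, if_neg h]
      field_simp
  have hstep : ∀ ρ a q, (A ρ + B ρ) * stepProb D γ ρ a q =
      A ρ * stepProb D α ρ a q + B ρ * stepProb D β ρ a q := by
    intro ρ a q
    simp only [stepProb, Finset.mul_sum, ← Finset.sum_add_distrib, ← mul_assoc, hγ, add_mul]
  have hrun : ∀ q0 l, probFrom D γ (q0, []) l = A (q0, l) + B (q0, l) := by
    intro q0 l
    induction l using List.reverseRecOn with
    | nil => simp [A, B, probFrom, hcd]
    | append_singleton l x ih =>
      obtain ⟨a, q⟩ := x
      rw [probFrom_append, ih]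
      simp only [List.nil_append, hstep]
      simp only [A, B, probFrom_append, List.nil_append, mul_assoc]
  refine ⟨γ, fun ρ => ⟨fun m => ?_, fun m hm => ?_, ?_⟩, fun ρ => ?_⟩
  · by_cases h : A ρ + B ρ = 0
    · simp only [γ, if_pos h]
      exact (hα ρ).1 m
    · simp only [γ, if_neg h]
      exact div_nonneg (add_nonneg (mul_nonneg (hA ρ) ((hα ρ).1 m))
        (mul_nonneg (hB ρ) ((hβ ρ).1 m))) (add_nonneg (hA ρ) (hB ρ))
  · simp [γ, (hα ρ).2.1 m hm, (hβ ρ).2.1 m hm]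
  · by_cases h : A ρ + B ρ = 0
    · simp only [γ, if_pos h]
      exact (hα ρ).2.2
    · simp only [γ, if_neg h]
      rw [← Finset.sum_div, Finset.sum_add_distrib, ← Finset.mul_sum, ← Finset.mul_sum,
        (hα ρ).2.2, (hβ ρ).2.2, mul_one, mul_one, div_self h]
  · simp only [pathProb, hrun, A, B]
    ring

lemma exists_strategy_Tr_mix {Q L M : Type*} [Fintype Q] [DecidableEq Q] {D : PreMDP Q L M}
    (hD : ∀ m a q, 0 ≤ D.prob m a q) {α β : MPath Q L → M → ℝ} (hα : IsStrategy D α)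
    (hβ : IsStrategy D β) {c d : ℝ} (hc : 0 ≤ c) (hd : 0 ≤ d) (hcd : c + d = 1) :
    ∃ γ, IsStrategy D γ ∧ Tr D γ = c • Tr D α + d • Tr D β := by
  obtain ⟨γ, hγ, h⟩ := exists_strategy_mix hD hα hβ hc hd hcd
  refine ⟨γ, hγ, funext fun w => ?_⟩
  simp only [Pi.add_apply, Pi.smul_apply, smul_eq_mul, Tr_eq_sum_pathProb, h,
    Finset.sum_add_distrib, Finset.mul_sum]

lemma exists_strategy_of_pick {Q L M : Type*} (D : PreMDP Q L M) (pick : Q → M)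
    (hpick : ∀ q, pick q ∈ D.moves q) :
    ∃ σ, IsStrategy D σ ∧ ∀ ρ, σ ρ (pick (MPath.last ρ)) = 1 := by
  classical
  refine ⟨fun ρ m => if m = pick (MPath.last ρ) then 1 else 0, fun ρ => ⟨fun m => ?_,
    fun m hm => if_neg ?_, ?_⟩, fun ρ => if_pos rfl⟩
  · dsimp only
    split_ifs <;> norm_num
  · rintro rfl
    exact hm (hpick _)
  · simp [hpick]

/-! ### Copies of an MDP behind a fresh initial state -/

/-- `F` contains, along `e` and `g`, a copy of `D` closed under transitions, not containing the
state `none`, and emitting only labels of the form `some a`. -/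
structure IsCopy {Q S L M N : Type*} (D : PreMDP Q L M) (F : PreMDP (Option S) (Option L) N)
    (e : Q ↪ S) (g : M ↪ N) : Prop where
  moves : ∀ q, F.moves (some (e q)) = (D.moves q).map g
  prob : ∀ m a q, F.prob (g m) (some a) (some (e q)) = D.prob m a q
  prob_none : ∀ m s, F.prob (g m) none s = 0
  prob_out : ∀ m a s, s ∉ Set.range (fun q => some (e q)) → F.prob (g m) a s = 0

/-- The path of `F` which enters the copy of `D` and follows the path `ρ` there. -/
def liftPath {Q S L : Type*} (e : Q ↪ S) (ρ : MPath Q L) : MPath (Option S) (Option L) :=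
  (none, (none, some (e ρ.1)) :: ρ.2.map (Prod.map some fun q => some (e q)))

lemma liftPath_injective {Q S L : Type*} (e : Q ↪ S) :
    Function.Injective (liftPath (L := L) e) := by
  rintro ⟨q, l⟩ ⟨q', l'⟩ h
  simp only [liftPath, Prod.mk.injEq, List.cons.injEq, true_and, Option.some.injEq,
    e.injective.eq_iff] at h
  have hinj : Function.Injective (Prod.map (some : L → Option L) fun q => some (e q)) :=
    (Option.some_injective _).prodMap ((Option.some_injective _).comp e.injective)
  rw [h.1, hinj.list_map h.2]

lemma last_liftPath {Q S L : Type*} (e : Q ↪ S) (ρ : MPath Q L) :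
    MPath.last (liftPath e ρ) = some (e (MPath.last ρ)) := by
  obtain ⟨q, l⟩ := ρ
  induction l using List.reverseRecOn with
  | nil => rfl
  | append_singleton l x _ =>
    rw [MPath.last_append]
    simp only [liftPath, List.map_append, List.map_cons, List.map_nil]
    rw [← List.cons_append, MPath.last_append]
    rfl

lemma liftPath_append {Q S L : Type*} (e : Q ↪ S) (ρ : MPath Q L) (a : L) (q : Q) :
    liftPath e (ρ.1, ρ.2 ++ [(a, q)]) =
      ((liftPath e ρ).1, (liftPath e ρ).2 ++ [(some a, some (e q))]) := by
  simp [liftPath]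

/-- The strategy induced on the copy. -/
def resStrategy {Q S L N M : Type*} (e : Q ↪ S) (g : M ↪ N)
    (σ : MPath (Option S) (Option L) → N → ℝ) : MPath Q L → M → ℝ :=
  fun ρ m => σ (liftPath e ρ) (g m)

namespace IsCopy

variable {Q S L M N : Type*} {D : PreMDP Q L M} {F : PreMDP (Option S) (Option L) N}
  {e : Q ↪ S} {g : M ↪ N}

lemma isStrategy_resStrategy (h : IsCopy D F e g) {σ : MPath (Option S) (Option L) → N → ℝ}
    (hσ : IsStrategy F σ) : IsStrategy D (resStrategy e g σ) := by
  intro ρ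
  obtain ⟨h0, h1, h2⟩ := hσ (liftPath e ρ)
  rw [last_liftPath, h.moves] at h1 h2
  refine ⟨fun m => h0 _, fun m hm => h1 _ (by simpa using hm), ?_⟩
  rwa [Finset.sum_map] at h2

/-- A strategy on the copy extends to `F`, with prescribed behaviour on other paths. -/
lemma exists_extension (h : IsCopy D F e g) {α : MPath Q L → M → ℝ} (hα : IsStrategy D α)
    {σ : MPath (Option S) (Option L) → N → ℝ} (hσ : IsStrategy F σ) :
    ∃ τ, IsStrategy F τ ∧ resStrategy e g τ = α ∧ τ (none, []) = σ (none, []) := by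
  classical
  let τ : MPath (Option S) (Option L) → N → ℝ :=
    Function.extend (liftPath e) (fun ρ => Function.extend g (α ρ) 0) σ
  have hτ : ∀ ρ, τ (liftPath e ρ) = Function.extend g (α ρ) 0 := fun ρ =>
    (liftPath_injective e).extend_apply _ _ ρ
  have hτ' : ∀ ρ, (¬ ∃ ρ', liftPath e ρ' = ρ) → τ ρ = σ ρ := fun ρ hρ =>
    Function.extend_apply' _ _ _ hρ
  refine ⟨τ, fun ρ => ?_, ?_, hτ' _ ?_⟩
  · by_cases hρ : ∃ ρ', liftPath e ρ' = ρ
    · obtain ⟨ρ, rfl⟩ := hρ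
      rw [last_liftPath, h.moves, hτ]
      refine ⟨fun n => ?_, fun n hn => ?_, ?_⟩
      · by_cases hn : ∃ m, g m = n
        · obtain ⟨m, rfl⟩ := hn
          rw [g.injective.extend_apply]
          exact (hα ρ).1 m
        · rw [Function.extend_apply' _ _ _ hn]
          rfl
      · by_cases hm : ∃ m, g m = n
        · obtain ⟨m, rfl⟩ := hm
          rw [g.injective.extend_apply]
          exact (hα ρ).2.1 m (by simpa using hn)
        · rw [Function.extend_apply' _ _ _ hm]
          rfl
      · rw [Finset.sum_map]
        simp only [g.injective.extend_apply]
        exact (hα ρ).2.2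
    · rw [hτ' ρ hρ]
      exact hσ ρ
  · funext ρ m
    rw [resStrategy, hτ, g.injective.extend_apply]
  · rintro ⟨ρ, hρ⟩
    simp [liftPath] at hρ

lemma stepProb_lift (h : IsCopy D F e g) (σ : MPath (Option S) (Option L) → N → ℝ)
    (ρ : MPath Q L) (a : L) (q : Q) :
    stepProb F σ (liftPath e ρ) (some a) (some (e q)) = stepProb D (resStrategy e g σ) ρ a q := by
  simp only [stepProb, last_liftPath, h.moves, Finset.sum_map, h.prob, resStrategy]

lemma stepProb_none (h : IsCopy D F e g) (σ : MPath (Option S) (Option L) → N → ℝ)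
    (ρ : MPath Q L) (s : Option S) : stepProb F σ (liftPath e ρ) none s = 0 := by
  simp [stepProb, last_liftPath, h.moves, Finset.sum_map, h.prob_none]

lemma traceFrom_cons_some [Fintype Q] [Fintype S] (h : IsCopy D F e g)
    (σ : MPath (Option S) (Option L) → N → ℝ) (ρ : MPath Q L) (a : L) (w : List (Option L)) :
    traceFrom F σ (liftPath e ρ) (some a :: w) =
      ∑ q, stepProb D (resStrategy e g σ) ρ a q *
        traceFrom F σ (liftPath e (ρ.1, ρ.2 ++ [(a, q)])) w := by
  rw [traceFrom]
  symm
  refine Fintype.sum_of_injective (fun q => some (e q))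
    ((Option.some_injective _).comp e.injective) _ _ (fun s hs => ?_) fun q => ?_
  · simp only [stepProb, last_liftPath, h.moves, Finset.sum_map, h.prob_out _ _ s hs, mul_zero,
      Finset.sum_const_zero, zero_mul]
  · rw [h.stepProb_lift, liftPath_append]

lemma traceFrom_lift [Fintype Q] [Fintype S] (h : IsCopy D F e g)
    (σ : MPath (Option S) (Option L) → N → ℝ) (ρ : MPath Q L) :
    traceFrom F σ (liftPath e ρ) =
      Function.extend (List.map some) (traceFrom D (resStrategy e g σ) ρ) 0 := by
  have hinj : Function.Injective (List.map (some : L → Option L)) :=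
    (Option.some_injective L).list_map
  funext w
  by_cases hw : ∃ u, List.map some u = w
  · obtain ⟨u, rfl⟩ := hw
    rw [hinj.extend_apply]
    induction u generalizing ρ with
    | nil => rfl
    | cons a u ih =>
      rw [List.map_cons, h.traceFrom_cons_some, traceFrom]
      simp only [ih]
  · rw [Function.extend_apply' _ _ _ hw, Pi.zero_apply]
    induction w generalizing ρ with
    | nil => exact absurd ⟨[], rfl⟩ hw
    | cons x w ih =>
      cases x with
      | none => simp [traceFrom, h.stepProb_none]
      | some a =>
        rw [h.traceFrom_cons_some]
        refine Finset.sum_eq_zero fun q _ => ?_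
        rw [ih, mul_zero]
        rintro ⟨u, rfl⟩
        exact hw ⟨a :: u, rfl⟩

/-- The total contribution of the runs entering the copy of `D`. -/
lemma sum_init_mul_traceFrom [Fintype Q] [DecidableEq Q] [Fintype S] (h : IsCopy D F e g)
    (σ : MPath (Option S) (Option L) → N → ℝ) (w : List (Option L)) :
    ∑ q, D.init q * traceFrom F σ (none, [(none, some (e q))]) w =
      Function.extend (List.map some) (Tr D (resStrategy e g σ)) 0 w := by
  have hinj : Function.Injective (List.map (some : L → Option L)) :=
    (Option.some_injective L).list_map
  have hl : ∀ q, traceFrom F σ (none, [(none, some (e q))]) =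
      Function.extend (List.map some) (traceFrom D (resStrategy e g σ) (q, [])) 0 :=
    fun q => h.traceFrom_lift σ (q, [])
  simp only [hl]
  by_cases hw : ∃ u, List.map some u = w
  · obtain ⟨u, rfl⟩ := hw
    simp only [hinj.extend_apply, Tr_eq_sum_traceFrom]
  · simp [Function.extend_apply' _ _ _ hw]

end IsCopy

/-- The trace function of an MDP which first emits the fresh label `none` and then behaves
according to the trace function `t`. -/
noncomputable def hashTrace {L : Type*} (t : List L → ℝ) : List (Option L) → ℝ
  | [] => 1
  | none :: w => Function.extend (List.map some) t 0 w
  | some _ :: _ => 0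

lemma hashTrace_injective {L : Type*} : Function.Injective (hashTrace (L := L)) := by
  intro t t' h
  funext u
  have hinj : Function.Injective (List.map (some : L → Option L)) :=
    (Option.some_injective L).list_map
  simpa only [hashTrace, hinj.extend_apply] using congrFun h (none :: u.map some)

section Constructions

variable {QD QE L MD ME : Type*} [DecidableEq MD] [DecidableEq ME]

lemma isCopy_plusMDP_left (D : PreMDP QD L MD) (E : PreMDP QE L ME) :
    IsCopy D (plusMDP D E) Function.Embedding.inl
      (Function.Embedding.inl.trans Function.Embedding.inr) where
  moves q := by
    rw [Finset.map_eq_image]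
    rfl
  prob m a q := rfl
  prob_none m s := rfl
  prob_out m a s hs := by
    rcases a with _ | a
    · rfl
    rcases s with _ | s | s
    · rfl
    · exact absurd ⟨s, rfl⟩ hs
    · rfl

lemma isCopy_plusMDP_right (D : PreMDP QD L MD) (E : PreMDP QE L ME) :
    IsCopy E (plusMDP D E) Function.Embedding.inr
      (Function.Embedding.inr.trans Function.Embedding.inr) where
  moves q := by
    rw [Finset.map_eq_image]
    rfl
  prob m a q := rfl
  prob_none m s := rfl
  prob_out m a s hs := by
    rcases a with _ | a
    · rfl
    rcases s with _ | s | s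
    · rfl
    · rfl
    · exact absurd ⟨s, rfl⟩ hs

lemma isCopy_extMDP (E : PreMDP QE L ME) :
    IsCopy E (extMDP E) (Function.Embedding.refl QE) Function.Embedding.some where
  moves q := by
    rw [Finset.map_eq_image]
    rfl
  prob m a q := rfl
  prob_none m s := rfl
  prob_out m a s hs := by
    rcases a with _ | a
    · rfl
    rcases s with _ | s
    · rfl
    · exact absurd ⟨s, rfl⟩ hs

lemma exists_strategy_plusMDP_pick (D : PreMDP QD L MD) (E : PreMDP QE L ME)
    (hD : ∀ q, (D.moves q).Nonempty) (hE : ∀ q, (E.moves q).Nonempty) (b : Bool) :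
    ∃ σ, IsStrategy (plusMDP D E) σ ∧ ∀ c, σ (none, []) (Sum.inl c) = if c = b then 1 else 0 := by
  choose f hf using hD
  choose g hg using hE
  obtain ⟨σ, hσ, h1⟩ := exists_strategy_of_pick (plusMDP D E)
    (fun s => s.elim (Sum.inl b) (Sum.elim (fun q => Sum.inr (Sum.inl (f q)))
      fun q => Sum.inr (Sum.inr (g q)))) (by
      rintro (_ | q | q)
      · cases b <;> simp [plusMDP]
      · simp [plusMDP, hf]
      · simp [plusMDP, hg])
  have h2 : σ (none, []) (Sum.inl b) = 1 := h1 (none, [])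
  have h3 : σ (none, []) (Sum.inl true) + σ (none, []) (Sum.inl false) = 1 := by
    simpa [plusMDP, MPath.last] using (hσ (none, [])).2.2
  refine ⟨σ, hσ, fun c => ?_⟩
  cases b <;> cases c <;> simp <;> linarith

variable [Fintype QD] [Fintype QE] [DecidableEq QD] [DecidableEq QE]

lemma Tr_extMDP (E : PreMDP QE L ME) {σ : MPath (Option QE) (Option L) → Option ME → ℝ}
    (hσ : IsStrategy (extMDP E) σ) :
    Tr (extMDP E) σ = hashTrace
      (Tr E (resStrategy (Function.Embedding.refl QE) Function.Embedding.some σ)) := by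
  have h1 : σ (none, []) none = 1 := by
    simpa [extMDP, MPath.last] using (hσ (none, [])).2.2
  funext w
  rw [Tr_eq_sum_traceFrom, Fintype.sum_option]
  simp only [extMDP, one_mul, zero_mul, Finset.sum_const_zero, add_zero]
  change traceFrom (extMDP E) σ _ _ = _
  rcases w with _ | ⟨_ | a, w⟩
  · rfl
  · rw [hashTrace, ← (isCopy_extMDP E).sum_init_mul_traceFrom, traceFrom, Fintype.sum_option]
    simp [stepProb, MPath.last, extMDP, h1]
  · simp [traceFrom, stepProb, MPath.last, extMDP, hashTrace]

lemma Tr_plusMDP (D : PreMDP QD L MD) (E : PreMDP QE L ME)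
    (σ : MPath (Option (QD ⊕ QE)) (Option L) → Bool ⊕ (MD ⊕ ME) → ℝ) :
    Tr (plusMDP D E) σ = hashTrace
      (σ (none, []) (Sum.inl true) • Tr D (resStrategy Function.Embedding.inl
          (Function.Embedding.inl.trans Function.Embedding.inr) σ) +
        σ (none, []) (Sum.inl false) • Tr E (resStrategy Function.Embedding.inr
          (Function.Embedding.inr.trans Function.Embedding.inr) σ)) := by
  have hext : ∀ (c d : ℝ) (s t : List L → ℝ) (w : List (Option L)),
      Function.extend (List.map some) (c • s + d • t) 0 w =
        c * Function.extend (List.map some) s 0 w +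
          d * Function.extend (List.map some) t 0 w := by
    intro c d s t w
    by_cases hw : ∃ u, List.map some u = w
    · obtain ⟨u, rfl⟩ := hw
      simp [(Option.some_injective L).list_map.extend_apply]
    · simp [Function.extend_apply' _ _ _ hw]
  funext w
  rw [Tr_eq_sum_traceFrom, Fintype.sum_option]
  simp only [plusMDP, one_mul, zero_mul, Finset.sum_const_zero, add_zero]
  change traceFrom (plusMDP D E) σ _ _ = _
  rcases w with _ | ⟨_ | a, w⟩
  · rfl
  · rw [hashTrace, hext, ← (isCopy_plusMDP_left D E).sum_init_mul_traceFrom,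
      ← (isCopy_plusMDP_right D E).sum_init_mul_traceFrom, traceFrom, Fintype.sum_option,
      Fintype.sum_sum_type, Finset.mul_sum, Finset.mul_sum]
    simp [stepProb, MPath.last, plusMDP, mul_assoc]
  · simp [traceFrom, stepProb, MPath.last, plusMDP, hashTrace]

/-- Every trace function of `E` is, prefixed by the fresh label, one of `extMDP E`. -/
lemma exists_strategy_extMDP (E : PreMDP QE L ME) (hE : ∀ q, (E.moves q).Nonempty)
    {α : MPath QE L → ME → ℝ} (hα : IsStrategy E α) :
    ∃ σ, IsStrategy (extMDP E) σ ∧ Tr (extMDP E) σ = hashTrace (Tr E α) := by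
  choose f hf using hE
  obtain ⟨σ, hσ, -⟩ := exists_strategy_of_pick (extMDP E)
    (fun s => s.map f) (by
      rintro (_ | q)
      · simp [extMDP]
      · simp [extMDP, hf])
  obtain ⟨τ, hτ, hres, -⟩ := (isCopy_extMDP E).exists_extension hα hσ
  exact ⟨τ, hτ, by rw [Tr_extMDP E hτ, hres]⟩

lemma exists_strategy_plusMDP_left (D : PreMDP QD L MD) (E : PreMDP QE L ME)
    (hD : ∀ q, (D.moves q).Nonempty) (hE : ∀ q, (E.moves q).Nonempty)
    {α : MPath QD L → MD → ℝ} (hα : IsStrategy D α) :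
    ∃ σ, IsStrategy (plusMDP D E) σ ∧ Tr (plusMDP D E) σ = hashTrace (Tr D α) := by
  obtain ⟨σ, hσ, h⟩ := exists_strategy_plusMDP_pick D E hD hE true
  obtain ⟨τ, hτ, hres, h0⟩ := (isCopy_plusMDP_left D E).exists_extension hα hσ
  exact ⟨τ, hτ, by rw [Tr_plusMDP, hres, h0, h, h]; simp⟩

lemma exists_strategy_plusMDP_right (D : PreMDP QD L MD) (E : PreMDP QE L ME)
    (hD : ∀ q, (D.moves q).Nonempty) (hE : ∀ q, (E.moves q).Nonempty)
    {α : MPath QE L → ME → ℝ} (hα : IsStrategy E α) :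
    ∃ σ, IsStrategy (plusMDP D E) σ ∧ Tr (plusMDP D E) σ = hashTrace (Tr E α) := by
  obtain ⟨σ, hσ, h⟩ := exists_strategy_plusMDP_pick D E hD hE false
  obtain ⟨τ, hτ, hres, h0⟩ := (isCopy_plusMDP_right D E).exists_extension hα hσ
  exact ⟨τ, hτ, by rw [Tr_plusMDP, hres, h0, h, h]; simp⟩

end Constructions

/-- (i) `E₂ ⊑ D+E` always holds; (ii) `D ⊑ E` iff both `E₂ ⊑ D+E` and
`D+E ⊑ E₂`. -/
theorem stmt17 {QD QE L MD ME : Type*} [Fintype QD] [Fintype QE] [Fintype L]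
    [Fintype MD] [Fintype ME] [DecidableEq QD] [DecidableEq QE]
    [DecidableEq MD] [DecidableEq ME]
    (D : PreMDP QD L MD) (E : PreMDP QE L ME) (hD : IsMDP D) (hE : IsMDP E) :
    Refines (extMDP E) (plusMDP D E) ∧
      (Refines D E ↔ (Refines (extMDP E) (plusMDP D E) ∧ Refines (plusMDP D E) (extMDP E))) := by
  obtain ⟨-, -, hDm, -, -⟩ := hD
  obtain ⟨-, -, hEm, hEp, -⟩ := hE
  have hext : Refines (extMDP E) (plusMDP D E) := by
    intro α hα
    obtain ⟨σ, hσ, h⟩ := exists_strategy_plusMDP_right D E hDm hEm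
      ((isCopy_extMDP E).isStrategy_resStrategy hα)
    exact ⟨σ, hσ, by rw [h, Tr_extMDP E hα]⟩
  refine ⟨hext, fun href => ⟨hext, fun α hα => ?_⟩, fun ⟨_, href⟩ α hα => ?_⟩
  · obtain ⟨β, hβ, hTr⟩ := href _ ((isCopy_plusMDP_left D E).isStrategy_resStrategy hα)
    have h0 := hα (none, [])
    have hsum : α (none, []) (Sum.inl true) + α (none, []) (Sum.inl false) = 1 := by
      simpa [plusMDP, MPath.last] using h0.2.2
    obtain ⟨γ, hγ, hmix⟩ := exists_strategy_Tr_mix hEp hβ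
      ((isCopy_plusMDP_right D E).isStrategy_resStrategy hα) (h0.1 _) (h0.1 _) hsum
    obtain ⟨σ, hσ, h⟩ := exists_strategy_extMDP E hEm hγ
    exact ⟨σ, hσ, by rw [h, hmix, Tr_plusMDP, hTr]⟩
  · obtain ⟨σ, hσ, h⟩ := exists_strategy_plusMDP_left D E hDm hEm hα
    obtain ⟨β, hβ, hTr⟩ := href σ hσ
    refine ⟨_, (isCopy_extMDP E).isStrategy_resStrategy hβ, hashTrace_injective ?_⟩
    rw [← h, hTr, Tr_extMDP E hβ]
end

section
/- Let M ∈ ℝ^{n×m} be a (row-)stochastic nonnegative matrix and r ∈ ℕ with r ≥ 1. Let C be the labelled MC over labels {a_1,…,a_n, b_1,…,b_m, c} with states q_in (initial, Dirac), q_1,…,q_n, q_fi, where from q_in the chain emits a_i and moves to q_i with probability 1/n for each i, from q_i it emits b_j and moves to q_fi with probability M[i,j], and q_fi loops forever emitting c. Let D be the labelled MDP with states p_1,…,p_n, ℓ_1,…,ℓ_r, p_fi, initial distribution uniform on {p_1,…,p_n}, where each p_i has moves m_{i,1},…,m_{i,r} with m_{i,k} the Dirac distribution on (a_i, ℓ_k),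 each ℓ_k has moves m'_{k,1},…,m'_{k,m} with m'_{k,j} the Dirac distribution on (b_j, p_fi), and p_fi loops forever emitting c. Then there exist stochastic matrices A ∈ ℝ^{n×r} and W ∈ ℝ^{r×m} with M = A·W if and only if there exists a memoryless strategy α of D with Tr_C = Tr_{D,α}. -/
open Matrix

/-- The unique strategy of an MC whose unique move at each state is named by the state. -/
def mcStrategy {Q L : Type*} [DecidableEq Q] : MPath Q L → Q → ℝ :=
  fun ρ m => if m = MPath.last ρ then 1 else 0

/-- A memoryless strategy: behaves like a local strategy applied at the last state. -/
def Memoryless {Q L M : Type*} (D : PreMDP Q L M) (α : MPath Q L → M → ℝ) : Prop :=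
  ∃ β : Q → M → ℝ, IsLocal D β ∧ ∀ (ρ : MPath Q L) (m : M), α ρ m = β (MPath.last ρ) m

/-- The MC `C` of the NMF reduction: states `q_in` (= `inl ()`), `q_1,…,q_n`
(= `inr (inl i)`), `q_fi` (= `inr (inr ())`); labels `a_i` (= `inl i`), `b_j`
(= `inr (inl j)`), `c` (= `inr (inr ())`). From `q_in` it emits `a_i` and moves to `q_i`
with probability `1/n`; from `q_i` it emits `b_j` and moves to `q_fi` with probability
`M[i,j]`; `q_fi` loops emitting `c`. -/
noncomputable def mcC19 (n m : ℕ) (M : Matrix (Fin n) (Fin m) ℝ) :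
    PreMDP (Unit ⊕ Fin n ⊕ Unit) (Fin n ⊕ Fin m ⊕ Unit) (Unit ⊕ Fin n ⊕ Unit) where
  init := fun st => match st with | Sum.inl _ => 1 | _ => 0
  moves := fun st => {st}
  prob := fun mv l st' => match mv, l, st' with
    | Sum.inl _, Sum.inl i, Sum.inr (Sum.inl i') => if i = i' then (1 : ℝ) / n else 0
    | Sum.inr (Sum.inl i), Sum.inr (Sum.inl j), Sum.inr (Sum.inr _) => M i j
    | Sum.inr (Sum.inr _), Sum.inr (Sum.inr _), Sum.inr (Sum.inr _) => 1
    | _, _, _ => 0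

/-- The MDP `D` of the NMF reduction: states `p_1,…,p_n` (= `inl i`, initial distribution
uniform), `ℓ_1,…,ℓ_r` (= `inr (inl k)`), `p_fi` (= `inr (inr ())`); state `p_i` has moves
`m_{i,k}` (Dirac on `(a_i, ℓ_k)`); state `ℓ_k` has moves `m'_{k,j}` (Dirac on `(b_j, p_fi)`);
`p_fi` loops emitting `c`. -/
noncomputable def mdpD19 (n m r : ℕ) :
    PreMDP (Fin n ⊕ Fin r ⊕ Unit) (Fin n ⊕ Fin m ⊕ Unit)
      ((Fin n × Fin r) ⊕ (Fin r × Fin m) ⊕ Unit) where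
  init := fun st => match st with | Sum.inl _ => (1 : ℝ) / n | _ => 0
  moves := fun st => match st with
    | Sum.inl i => Finset.univ.image fun k : Fin r => Sum.inl (i, k)
    | Sum.inr (Sum.inl k) => Finset.univ.image fun j : Fin m => Sum.inr (Sum.inl (k, j))
    | Sum.inr (Sum.inr _) => {Sum.inr (Sum.inr ())}
  prob := fun mv l st' => match mv, l, st' with
    | Sum.inl (i, k), Sum.inl i', Sum.inr (Sum.inl k') =>
        if i = i' ∧ k = k' then 1 else 0
    | Sum.inr (Sum.inl (_, j)), Sum.inr (Sum.inl j'), Sum.inr (Sum.inr _) =>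
        if j = j' then 1 else 0
    | Sum.inr (Sum.inr _), Sum.inr (Sum.inr _), Sum.inr (Sum.inr _) => 1
    | _, _, _ => 0

/-- Probability that a word is generated from state `q` under the local strategy `β`. -/
noncomputable def wordProb {Q L M : Type*} [Fintype Q] (D : PreMDP Q L M) (β : Q → M → ℝ) :
    List L → Q → ℝ
  | [], _ => 1
  | a :: w, q => ∑ q', transMat D β a q q' * wordProb D β w q'

theorem MPath.last_append_singleton {Q L : Type*} (q : Q) (l : List (L × Q)) (a : L) (q' : Q) :
    MPath.last ((q, l ++ [(a, q')]) : MPath Q L) = q' := by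
  simp [MPath.last]

theorem sum_probFrom_eq_wordProb {Q L M : Type*} [Fintype Q] (D : PreMDP Q L M)
    {α : MPath Q L → M → ℝ} {β : Q → M → ℝ} (h : ∀ ρ m, α ρ m = β (MPath.last ρ) m)
    (w : List L) (ρ : MPath Q L) :
    ∑ f : Fin w.length → Q, probFrom D α ρ (List.ofFn fun i => (w.get i, f i)) =
      wordProb D β w (MPath.last ρ) := by
  induction w generalizing ρ with
  | nil => simp [probFrom, wordProb]
  | cons a w ih =>
    refine ((Fin.consEquiv fun _ : Fin (w.length + 1) => Q).sum_comp _).symm.trans ?_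
    rw [Fintype.sum_prod_type]
    simp only [wordProb]
    refine Finset.sum_congr rfl fun q' _ => ?_
    have := ih (ρ.1, ρ.2 ++ [(a, q')])
    rw [MPath.last_append_singleton] at this
    rw [← this, Finset.mul_sum]
    refine Finset.sum_congr rfl fun f _ => ?_
    simp [Fin.consEquiv, List.ofFn_succ, probFrom, transMat, h]

theorem Tr_eq_sum_wordProb {Q L M : Type*} [Fintype Q] [DecidableEq Q] (D : PreMDP Q L M)
    {α : MPath Q L → M → ℝ} {β : Q → M → ℝ} (h : ∀ ρ m, α ρ m = β (MPath.last ρ) m)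
    (w : List L) : Tr D α w = ∑ q, D.init q * wordProb D β w q := by
  unfold Tr subDis
  rw [Finset.sum_comm]
  refine Finset.sum_congr rfl fun q _ => ?_
  rw [Finset.sum_comm]
  simp only [Finset.sum_ite_eq, Finset.mem_univ, if_true, pathProb]
  rw [← Finset.mul_sum, sum_probFrom_eq_wordProb D h]
  rfl

section Reduction

variable {n m r : ℕ}

/-- Probability of generating a word from a state that loops forever on the label `c`. -/
def loopProb {n m : ℕ} : List (Fin n ⊕ Fin m ⊕ Unit) → ℝ
  | [] => 1
  | Sum.inr (Sum.inr _) :: w => loopProb w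
  | _ :: _ => 0

/-- The trace-probability function of the reduction, in terms of the product matrix `P`. -/
noncomputable def reductionTr {n m : ℕ} (P : Matrix (Fin n) (Fin m) ℝ) :
    List (Fin n ⊕ Fin m ⊕ Unit) → ℝ
  | [] => 1
  | [Sum.inl _] => 1 / n
  | Sum.inl i :: Sum.inr (Sum.inl j) :: w => 1 / n * (P i j * loopProb w)
  | _ => 0

theorem reductionTr_injective (hn : 0 < n) :
    Function.Injective (reductionTr : Matrix (Fin n) (Fin m) ℝ → _) := by
  intro P P' h
  ext i j
  have := congrFun h [Sum.inl i, Sum.inr (Sum.inl j)]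
  simpa [reductionTr, loopProb, hn.ne'] using this

theorem wordProb_mcC19_final (M : Matrix (Fin n) (Fin m) ℝ) (w : List (Fin n ⊕ Fin m ⊕ Unit)) :
    wordProb (mcC19 n m M) (fun q q' => if q' = q then 1 else 0) w (Sum.inr (Sum.inr ())) =
      loopProb w := by
  induction w with
  | nil => rfl
  | cons a w ih =>
    rcases a with i | j | _ <;> simp [wordProb, loopProb, transMat, mcC19] at ih ⊢
    exact ih

theorem Tr_mcC19 (M : Matrix (Fin n) (Fin m) ℝ) :
    Tr (mcC19 n m M) mcStrategy = reductionTr M := by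
  funext w
  rw [Tr_eq_sum_wordProb _ (α := mcStrategy) (β := fun q q' => if q' = q then 1 else 0) fun _ _ => rfl]
  have hf := wordProb_mcC19_final M
  rcases w with _ | ⟨i | j | _, _ | ⟨i' | j' | _, w⟩⟩ <;>
    simp [wordProb, reductionTr, transMat, mcC19] at hf ⊢
  exact Or.inl (Or.inl (hf w))

variable {β : Fin n ⊕ Fin r ⊕ Unit → (Fin n × Fin r) ⊕ (Fin r × Fin m) ⊕ Unit → ℝ}

theorem sum_moves_inl (i : Fin n) (g : (Fin n × Fin r) ⊕ (Fin r × Fin m) ⊕ Unit → ℝ) :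
    ∑ x ∈ (mdpD19 n m r).moves (Sum.inl i), g x = ∑ k, g (Sum.inl (i, k)) :=
  Finset.sum_image (by intro; simp)

theorem sum_moves_inr_inl (k : Fin r) (g : (Fin n × Fin r) ⊕ (Fin r × Fin m) ⊕ Unit → ℝ) :
    ∑ x ∈ (mdpD19 n m r).moves (Sum.inr (Sum.inl k)), g x = ∑ j, g (Sum.inr (Sum.inl (k, j))) :=
  Finset.sum_image (by intro; simp)

theorem sum_moves_inr_inr (g : (Fin n × Fin r) ⊕ (Fin r × Fin m) ⊕ Unit → ℝ) :
    ∑ x ∈ (mdpD19 n m r).moves (Sum.inr (Sum.inr ())), g x = g (Sum.inr (Sum.inr ())) :=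
  Finset.sum_singleton _ _

theorem wordProb_mdpD19_final (hβ : IsLocal (mdpD19 n m r) β)
    (w : List (Fin n ⊕ Fin m ⊕ Unit)) :
    wordProb (mdpD19 n m r) β w (Sum.inr (Sum.inr ())) = loopProb w := by
  have h1 := (hβ (Sum.inr (Sum.inr ()))).2.2
  rw [sum_moves_inr_inr] at h1
  induction w with
  | nil => rfl
  | cons a w ih =>
    rcases a with i | j | _ <;>
      simp [wordProb, loopProb, transMat, sum_moves_inr_inr, h1, ih] <;> simp [mdpD19]

theorem wordProb_mdpD19_middle (hβ : IsLocal (mdpD19 n m r) β) (k : Fin r)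
    (a : Fin n ⊕ Fin m ⊕ Unit) (w : List (Fin n ⊕ Fin m ⊕ Unit)) :
    wordProb (mdpD19 n m r) β (a :: w) (Sum.inr (Sum.inl k)) =
      match a with
      | Sum.inr (Sum.inl j) => β (Sum.inr (Sum.inl k)) (Sum.inr (Sum.inl (k, j))) * loopProb w
      | _ => 0 := by
  rcases a with i | j | _ <;>
    simp [wordProb, transMat, sum_moves_inr_inl, wordProb_mdpD19_final hβ] <;> simp [mdpD19]

theorem wordProb_mdpD19_initial (i : Fin n) (a : Fin n ⊕ Fin m ⊕ Unit)
    (w : List (Fin n ⊕ Fin m ⊕ Unit)) :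
    wordProb (mdpD19 n m r) β (a :: w) (Sum.inl i) =
      match a with
      | Sum.inl i' => if i = i' then
          ∑ k, β (Sum.inl i) (Sum.inl (i, k)) * wordProb (mdpD19 n m r) β w (Sum.inr (Sum.inl k))
        else 0
      | _ => 0 := by
  simp only [wordProb, transMat, Matrix.of_apply, sum_moves_inl, Fintype.sum_sum_type]
  generalize wordProb (mdpD19 n m r) β w = g
  rcases a with i' | j | _ <;> simp [mdpD19, ite_and]

theorem Tr_mdpD19 (hn : 0 < n) (hβ : IsLocal (mdpD19 n m r) β)
    {α : MPath (Fin n ⊕ Fin r ⊕ Unit) (Fin n ⊕ Fin m ⊕ Unit) →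
      (Fin n × Fin r) ⊕ (Fin r × Fin m) ⊕ Unit → ℝ}
    (h : ∀ ρ x, α ρ x = β (MPath.last ρ) x) :
    Tr (mdpD19 n m r) α = reductionTr
      ((Matrix.of fun i k => β (Sum.inl i) (Sum.inl (i, k))) *
        Matrix.of fun k j => β (Sum.inr (Sum.inl k)) (Sum.inr (Sum.inl (k, j)))) := by
  funext w
  rw [Tr_eq_sum_wordProb _ h]
  have h1 (i) := (hβ (Sum.inl i)).2.2
  simp only [sum_moves_inl] at h1
  have hinit (g : Fin n ⊕ Fin r ⊕ Unit → ℝ) :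
      ∑ q, (mdpD19 n m r).init q * g q = ∑ i, 1 / n * g (Sum.inl i) := by
    simp [mdpD19]
  rw [hinit]
  rcases w with _ | ⟨i | j | _, _ | ⟨i' | j' | _, w⟩⟩ <;>
    simp only [reductionTr, wordProb_mdpD19_initial, wordProb_mdpD19_middle hβ] <;>
    simp [wordProb, hn.ne', h1, Matrix.mul_apply, Finset.sum_mul, mul_assoc]

end Reduction

/-- NMF into stochastic factors reduces to `MC ⊑ MDP` with memoryless
strategies. -/
theorem stmt19 (n m r : ℕ) (hn : 0 < n) (hm : 0 < m) (hr : 1 ≤ r)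
    (M : Matrix (Fin n) (Fin m) ℝ)
    (hM0 : ∀ i j, 0 ≤ M i j) (hMrow : ∀ i, ∑ j, M i j = 1) :
    (∃ (A : Matrix (Fin n) (Fin r) ℝ) (W : Matrix (Fin r) (Fin m) ℝ),
        (∀ i k, 0 ≤ A i k) ∧ (∀ i, ∑ k, A i k = 1) ∧
        (∀ k j, 0 ≤ W k j) ∧ (∀ k, ∑ j, W k j = 1) ∧ M = A * W) ↔
    (∃ α, IsStrategy (mdpD19 n m r) α ∧ Memoryless (mdpD19 n m r) α ∧
      Tr (mcC19 n m M) mcStrategy = Tr (mdpD19 n m r) α) := by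
  constructor
  · rintro ⟨A, W, hA, hA1, hW, hW1, rfl⟩
    let β : Fin n ⊕ Fin r ⊕ Unit → (Fin n × Fin r) ⊕ (Fin r × Fin m) ⊕ Unit → ℝ
      | Sum.inl i, Sum.inl (i', k) => if i = i' then A i k else 0
      | Sum.inr (Sum.inl k), Sum.inr (Sum.inl (k', j)) => if k = k' then W k j else 0
      | Sum.inr (Sum.inr _), Sum.inr (Sum.inr _) => 1
      | _, _ => 0
    have hβ : IsLocal (mdpD19 n m r) β := by
      rintro (i | k | _)
      · refine ⟨?_, ?_, ?_⟩
        · rintro (⟨i', k⟩ | ⟨k, j⟩ | _) <;> simp only [β] <;> try split_ifs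
          all_goals simp [hA]
        · rintro (⟨i', k⟩ | ⟨k, j⟩ | _) <;> simp +contextual [β, mdpD19]
        · simp [sum_moves_inl, β, hA1]
      · refine ⟨?_, ?_, ?_⟩
        · rintro (⟨i', k⟩ | ⟨k, j⟩ | _) <;> simp only [β] <;> try split_ifs
          all_goals simp [hW]
        · rintro (⟨i', k⟩ | ⟨k, j⟩ | _) <;> simp +contextual [β, mdpD19]
        · simp [sum_moves_inr_inl, β, hW1]
      · refine ⟨?_, ?_, ?_⟩
        · rintro (⟨i', k⟩ | ⟨k, j⟩ | _) <;> simp [β]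
        · rintro (⟨i', k⟩ | ⟨k, j⟩ | _) <;> simp +contextual [β, mdpD19]
        · rw [sum_moves_inr_inr]
    refine ⟨fun ρ => β (MPath.last ρ), fun ρ => hβ _, ⟨β, hβ, fun _ _ => rfl⟩, ?_⟩
    rw [Tr_mcC19, Tr_mdpD19 hn hβ fun _ _ => rfl]
    congr 1
    ext i j
    simp [Matrix.mul_apply, β]
  · rintro ⟨α, -, ⟨β, hβ, h⟩, hTr⟩
    rw [Tr_mcC19, Tr_mdpD19 hn hβ h] at hTr
    refine ⟨_, _, fun i k => (hβ _).1 _, fun i => ?_, fun k j => (hβ _).1 _, fun k => ?_,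
      reductionTr_injective hn hTr⟩
    · simpa only [sum_moves_inl] using (hβ (Sum.inl i)).2.2
    · simpa only [sum_moves_inr_inl] using (hβ (Sum.inr (Sum.inl k))).2.2
end
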